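/- Let δ be the derivation of K[U_3,V_3] = K[u_1,u_2,u_3,v_1,v_2,v_3] with δ(u_1) = 0, δ(u_2) = u_1, δ(u_3) = u_2, δ(v_1) = 0, δ(v_2) = v_1, δ(v_3) = v_2, and set f_1 = u_1, f_2 = v_1, f_3 = u_2² − 2u_1u_3, f_4 = v_2² − 2v_1v_3, f_5 = u_1v_3 − u_2v_2 + u_3v_1, f_6 = u_1v_2 − u_2v_1. Then: (1) f_1,…,f_6 all lie in the algebra of constants K[U_3,V_3]^δ; (2) f_6² = f_1²f_4 + f_2²f_3 + 2f_1f_2f_5; (3) f_1, f_2, f_3, f_4, f_5 are algebraically independent over K; and (4) K[U_3,V_3]^δ is a free module over K[f_1,f_2,f_3,f_4,f_5] with basis {1, f_6}; in particular K[U_3,V_3]^δ is generated as a K-algebra by f_1,…,f_6 with the single defining relation f_6² = f_1²f_4 + f_2²f_3 + 2f_1f_2f_5. -/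

import Mathlib

noncomputable section

/-- `K[U₃,V₃] = K[u₁,u₂,u₃,v₁,v₂,v₃]`. -/
abbrev PolyUV3 (K : Type*) [CommRing K] := MvPolynomial (Fin 3 ⊕ Fin 3) K

def uP (K : Type*) [CommRing K] (i : Fin 3) : PolyUV3 K := MvPolynomial.X (Sum.inl i)
def vP (K : Type*) [CommRing K] (i : Fin 3) : PolyUV3 K := MvPolynomial.X (Sum.inr i)

def f1 (K : Type*) [CommRing K] : PolyUV3 K := uP K 0
def f2 (K : Type*) [CommRing K] : PolyUV3 K := vP K 0
def f3 (K : Type*) [CommRing K] : PolyUV3 K := uP K 1 ^ 2 - 2 * uP K 0 * uP K 2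
def f4 (K : Type*) [CommRing K] : PolyUV3 K := vP K 1 ^ 2 - 2 * vP K 0 * vP K 2
def f5 (K : Type*) [CommRing K] : PolyUV3 K :=
  uP K 0 * vP K 2 - uP K 1 * vP K 1 + uP K 2 * vP K 0
def f6 (K : Type*) [CommRing K] : PolyUV3 K := uP K 0 * vP K 1 - uP K 1 * vP K 0

/-- evaluation homomorphism sending the six polynomial generators to `f₁,…,f₆`. -/
def evF (K : Type*) [CommRing K] : MvPolynomial (Fin 6) K →ₐ[K] PolyUV3 K :=
  MvPolynomial.aeval ![f1 K, f2 K, f3 K, f4 K, f5 K, f6 K]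

/-- Evaluation of five variables at `f₁,…,f₅`. -/
def phiF (K : Type*) [CommRing K] : MvPolynomial (Fin 5) K →ₐ[K] PolyUV3 K :=
  MvPolynomial.aeval ![f1 K, f2 K, f3 K, f4 K, f5 K]

section helpers
open MvPolynomial

variable {K : Type*} [Field K] [CharZero K]

lemma f6_sq_aux (K : Type*) [CommRing K] :
    f6 K ^ 2 = f1 K ^ 2 * f4 K + f2 K ^ 2 * f3 K + 2 * f1 K * f2 K * f5 K := by
  unfold f1 f2 f3 f4 f5 f6; ring

/-- setting the zeroth variable to zero -/
def sub0 (K : Type*) [CommRing K] : MvPolynomial (Fin 5) K →ₐ[K] MvPolynomial (Fin 5) K :=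
  aeval ![0, X 1, X 2, X 3, X 4]

def muF (K : Type*) [CommRing K] : MvPolynomial (Fin 5) K →ₐ[K] MvPolynomial (Fin 5) K :=
  aeval ![0, X 1, X 2 ^ 2, X 3, X 4]

lemma X0_dvd_of_sub0 (a : MvPolynomial (Fin 5) K) (h : sub0 K a = 0) :
    (X 0 : MvPolynomial (Fin 5) K) ∣ a := by
  have key : (Ideal.Quotient.mkₐ K (Ideal.span {(X 0 : MvPolynomial (Fin 5) K)})).comp (sub0 K)
      = Ideal.Quotient.mkₐ K (Ideal.span {(X 0 : MvPolynomial (Fin 5) K)}) := by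
    apply MvPolynomial.algHom_ext
    intro i
    fin_cases i <;> simp [sub0]
  have h2 := DFunLike.congr_fun key a
  rw [AlgHom.comp_apply, h, map_zero] at h2
  have h3 : a ∈ Ideal.span {(X 0 : MvPolynomial (Fin 5) K)} := by
    rw [← Ideal.Quotient.eq_zero_iff_mem]
    exact h2.symm
  exact Ideal.mem_span_singleton.mp h3

lemma X0_dvd_of_mu (a : MvPolynomial (Fin 5) K) (h : muF K a = 0) :
    (X 0 : MvPolynomial (Fin 5) K) ∣ a := by
  apply X0_dvd_of_sub0
  have key : (aeval ![X 0 ^ 2, X 1 ^ 2, X 2, X 3 ^ 2, X 4 ^ 2] :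
      MvPolynomial (Fin 5) K →ₐ[K] MvPolynomial (Fin 5) K).comp (muF K)
      = (expand 2).comp (sub0 K) := by
    apply MvPolynomial.algHom_ext
    intro i
    fin_cases i <;> simp [sub0, muF]
  have h2 := DFunLike.congr_fun key a
  rw [AlgHom.comp_apply, AlgHom.comp_apply, h, map_zero] at h2
  have inj : Function.Injective (expand 2 : MvPolynomial (Fin 5) K →ₐ[K] MvPolynomial (Fin 5) K) := by
    exact expand_injective (by norm_num)
  apply inj
  rw [← h2, map_zero]

lemma key_dvd_aux (L : Type*) [Field L] [Algebra (MvPolynomial (Fin 5) K) L] [Algebra K L]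
    [IsScalarTower K (MvPolynomial (Fin 5) K) L] [IsFractionRing (MvPolynomial (Fin 5) K) L]
    (a b : MvPolynomial (Fin 5) K) (r : PolyUV3 K)
    (h : phiF K a + phiF K b * f6 K = f1 K * r) :
    (X 0 : MvPolynomial (Fin 5) K) ∣ a ∧ (X 0 : MvPolynomial (Fin 5) K) ∣ b := by
  let j : MvPolynomial (Fin 5) K →ₐ[K] L := IsScalarTower.toAlgHom K _ L
  have jinj : Function.Injective j := IsFractionRing.injective (MvPolynomial (Fin 5) K) L
  have hy : j (X 1) ≠ 0 := by
    rw [← map_zero j]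
    exact fun h => (X_ne_zero (R := K) (1 : Fin 5)) (jinj h)
  have h2 : (2 : L) ≠ 0 := by
    have : (algebraMap K L) 2 ≠ 0 := by
      rw [Ne, map_eq_zero]; norm_num
    rwa [map_ofNat] at this
  let H : PolyUV3 K →ₐ[K] L := aeval (Sum.elim ![0, j (X 2), j (X 4) / j (X 1)]
    ![j (X 1), 0, - j (X 3) / (2 * j (X 1))])
  have H1 : H (f1 K) = 0 := by simp [H, f1, uP]
  have H2 : H (f2 K) = j (X 1) := by simp [H, f2, vP]
  have H3 : H (f3 K) = j (X 2) ^ 2 := by simp [H, f3, uP]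
  have H4 : H (f4 K) = j (X 3) := by
    simp [H, f4, vP]; field_simp
  have H5 : H (f5 K) = j (X 4) := by
    simp [H, f5, vP, uP]; field_simp
  have H6 : H (f6 K) = - (j (X 2) * j (X 1)) := by simp [H, f6, uP, vP]
  have comp : H.comp (phiF K) = j.comp (muF K) := by
    apply MvPolynomial.algHom_ext
    intro i
    fin_cases i <;> simp [phiF, muF, H1, H2, H3, H4, H5]
  have e1 : muF K a - muF K b * (X 2 * X 1) = 0 := by
    apply jinj
    have c1 := DFunLike.congr_fun comp a
    have c2 := DFunLike.congr_fun comp b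
    simp only [AlgHom.comp_apply] at c1 c2
    have := congrArg H h
    rw [map_add, map_mul, map_mul, H1, H6, c1, c2] at this
    rw [map_sub, map_mul, map_mul, map_zero]
    linear_combination this
  let σ : MvPolynomial (Fin 5) K →ₐ[K] MvPolynomial (Fin 5) K :=
    aeval ![X 0, X 1, - X 2, X 3, X 4]
  have hσ : σ.comp (muF K) = muF K := by
    apply MvPolynomial.algHom_ext
    intro i
    fin_cases i <;> simp [σ, muF]
  have e2 : muF K a + muF K b * (X 2 * X 1) = 0 := by
    have c1 := DFunLike.congr_fun hσ a
    have c2 := DFunLike.congr_fun hσ b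
    simp only [AlgHom.comp_apply] at c1 c2
    have := congrArg σ e1
    rw [map_sub, map_mul, map_mul, c1, c2, map_zero] at this
    simp [σ] at this
    linear_combination this
  have h2' : (2 : MvPolynomial (Fin 5) K) ≠ 0 := two_ne_zero
  constructor
  · apply X0_dvd_of_mu
    have : 2 * muF K a = 0 := by linear_combination e1 + e2
    exact (mul_eq_zero.mp this).resolve_left h2'
  · apply X0_dvd_of_mu
    have : (2 * (X 2 * X 1)) * muF K b = 0 := by linear_combination e2 - e1
    exact (mul_eq_zero.mp this).resolve_left
      (mul_ne_zero h2' (mul_ne_zero (X_ne_zero _) (X_ne_zero _)))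

lemma key_dvd (a b : MvPolynomial (Fin 5) K) (r : PolyUV3 K)
    (h : phiF K a + phiF K b * f6 K = f1 K * r) :
    (X 0 : MvPolynomial (Fin 5) K) ∣ a ∧ (X 0 : MvPolynomial (Fin 5) K) ∣ b :=
  key_dvd_aux (FractionRing (MvPolynomial (Fin 5) K)) a b r h

lemma f1_ne : f1 K ≠ 0 := X_ne_zero _

lemma phi_X0 (a : MvPolynomial (Fin 5) K) : phiF K (X 0 * a) = f1 K * phiF K a := by
  simp [phiF]

lemma pow_dvd (n : ℕ) : ∀ a b : MvPolynomial (Fin 5) K, phiF K a + phiF K b * f6 K = 0 →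
    (X 0 : MvPolynomial (Fin 5) K) ^ n ∣ a ∧ (X 0 : MvPolynomial (Fin 5) K) ^ n ∣ b := by
  induction n with
  | zero => intro a b _; simp
  | succ n ih =>
    intro a b h
    obtain ⟨⟨a', rfl⟩, ⟨b', rfl⟩⟩ := key_dvd a b 0 (by rw [h, mul_zero])
    rw [phi_X0, phi_X0] at h
    have : f1 K * (phiF K a' + phiF K b' * f6 K) = 0 := by linear_combination h
    obtain ⟨h1, h2⟩ := ih a' b' ((mul_eq_zero.mp this).resolve_left f1_ne)
    rw [pow_succ']
    exact ⟨mul_dvd_mul_left _ h1, mul_dvd_mul_left _ h2⟩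

lemma eq_zero_of_pow_dvd (a : MvPolynomial (Fin 5) K)
    (h : ∀ n, (X 0 : MvPolynomial (Fin 5) K) ^ n ∣ a) : a = 0 := by
  by_contra ha
  have hX : ¬ IsUnit (X 0 : MvPolynomial (Fin 5) K) := by
    intro hu
    have := hu.map (aeval (fun _ => (0 : K)) : MvPolynomial (Fin 5) K →ₐ[K] K)
    simp at this
  obtain ⟨n, hn⟩ := FiniteMultiplicity.of_not_isUnit hX ha
  exact hn (h _)

lemma indep (a b : MvPolynomial (Fin 5) K) (h : phiF K a + phiF K b * f6 K = 0) :
    a = 0 ∧ b = 0 :=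
  ⟨eq_zero_of_pow_dvd a fun n => (pow_dvd n a b h).1,
   eq_zero_of_pow_dvd b fun n => (pow_dvd n a b h).2⟩

/-- the relation -/
def relF (K : Type*) [CommRing K] : MvPolynomial (Fin 6) K :=
  X 5 ^ 2 - (X 0 ^ 2 * X 3 + X 1 ^ 2 * X 2 + 2 * X 0 * X 1 * X 4)

def iotaF (K : Type*) [CommRing K] : MvPolynomial (Fin 5) K →ₐ[K] MvPolynomial (Fin 6) K :=
  aeval ![X 0, X 1, X 2, X 3, X 4]

lemma ev_iota (a : MvPolynomial (Fin 5) K) : evF K (iotaF K a) = phiF K a := by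
  have : (evF K).comp (iotaF K) = phiF K := by
    apply MvPolynomial.algHom_ext
    intro i
    fin_cases i <;> simp [evF, iotaF, phiF]
  exact DFunLike.congr_fun this a

lemma ev_X5 : evF K (X 5) = f6 K := by simp [evF]

lemma ev_rel : evF K (relF K) = 0 := by
  have := f6_sq_aux K
  rw [relF]
  simp only [map_sub, map_add, map_mul, map_pow, map_ofNat]
  simp [evF]
  linear_combination this

lemma normal_form (g : MvPolynomial (Fin 6) K) :
    ∃ a b, ∃ c, g = iotaF K a + iotaF K b * X 5 + c * relF K := by
  induction g using MvPolynomial.induction_on with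
  | C x => exact ⟨C x, 0, 0, by simp [iotaF]⟩
  | add p q hp hq =>
    obtain ⟨a, b, c, rfl⟩ := hp
    obtain ⟨a', b', c', rfl⟩ := hq
    exact ⟨a + a', b + b', c + c', by simp only [map_add]; ring⟩
  | mul_X p i hp =>
    obtain ⟨a, b, c, rfl⟩ := hp
    have main : ∀ i : Fin 5, ∃ a1 b1 c1, (iotaF K a + iotaF K b * X 5 + c * relF K) * iotaF K (X i)
        = iotaF K a1 + iotaF K b1 * X 5 + c1 * relF K := by
      intro i
      exact ⟨a * X i, b * X i, c * iotaF K (X i), by simp only [map_mul]; ring⟩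
    fin_cases i
    · simpa [iotaF] using main 0
    · simpa [iotaF] using main 1
    · simpa [iotaF] using main 2
    · simpa [iotaF] using main 3
    · simpa [iotaF] using main 4
    · refine ⟨b * (X 0 ^ 2 * X 3 + X 1 ^ 2 * X 2 + 2 * X 0 * X 1 * X 4), a,
        c * X 5 + iotaF K b, ?_⟩
      have : iotaF K (X 0 ^ 2 * X 3 + X 1 ^ 2 * X 2 + 2 * X 0 * X 1 * X 4) = 
        X 0 ^ 2 * X 3 + X 1 ^ 2 * X 2 + 2 * X 0 * X 1 * X 4 := by
        simp only [map_add, map_mul, map_pow, map_ofNat]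
        simp [iotaF]
      rw [map_mul, this]
      simp only [relF]
      show _ * X 5 = _
      ring

lemma range_form (g : MvPolynomial (Fin 6) K) :
    ∃ a b, evF K g = phiF K a + phiF K b * f6 K := by
  obtain ⟨a, b, c, rfl⟩ := normal_form g
  refine ⟨a, b, ?_⟩
  rw [map_add, map_add, map_mul, map_mul, ev_rel, ev_iota, ev_iota, ev_X5, mul_zero, add_zero]

lemma form_range (a b : MvPolynomial (Fin 5) K) :
    phiF K a + phiF K b * f6 K ∈ (evF K).range :=
  ⟨iotaF K a + iotaF K b * X 5, by simp [ev_iota, ev_X5]⟩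

lemma range_of_mul (p : PolyUV3 K) (h : f1 K * p ∈ (evF K).range) : p ∈ (evF K).range := by
  obtain ⟨g, hg⟩ := h
  obtain ⟨a, b, hab⟩ := range_form g
  have hg' : phiF K a + phiF K b * f6 K = f1 K * p := by rw [← hab]; exact hg
  obtain ⟨⟨a', rfl⟩, ⟨b', rfl⟩⟩ := key_dvd a b p hg'
  rw [phi_X0, phi_X0] at hg'
  have : p = phiF K a' + phiF K b' * f6 K := by
    apply mul_left_cancel₀ (f1_ne (K := K))
    rw [← hg']; ring
  rw [this]
  exact form_range _ _

lemma range_of_pow_mul (n : ℕ) (p : PolyUV3 K) (h : f1 K ^ n * p ∈ (evF K).range) :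
    p ∈ (evF K).range := by
  induction n with
  | zero => simpa using h
  | succ n ih =>
    apply ih
    apply range_of_mul
    rwa [← mul_assoc, ← pow_succ']

lemma mem_range_f (i : Fin 6) :
    ![f1 K, f2 K, f3 K, f4 K, f5 K, f6 K] i ∈ (evF K).range :=
  ⟨X i, by simp [evF]⟩

/-- Taylor map `exp(Tδ)`. -/
def taylorF (K : Type*) [Field K] : PolyUV3 K →ₐ[K] Polynomial (PolyUV3 K) :=
  aeval (Sum.elim
    ![Polynomial.C (uP K 0), Polynomial.C (uP K 1) + Polynomial.C (uP K 0) * Polynomial.X,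
      Polynomial.C (uP K 2) + Polynomial.C (uP K 1) * Polynomial.X
        + Polynomial.C (C (1/2) * uP K 0) * Polynomial.X ^ 2]
    ![Polynomial.C (vP K 0), Polynomial.C (vP K 1) + Polynomial.C (vP K 0) * Polynomial.X,
      Polynomial.C (vP K 2) + Polynomial.C (vP K 1) * Polynomial.X
        + Polynomial.C (C (1/2) * vP K 0) * Polynomial.X ^ 2])

lemma half_two : (C (1/2) : PolyUV3 K) * 2 = 1 := by
  have : (2 : PolyUV3 K) = C 2 := (map_ofNat C 2).symm
  rw [this, ← C_mul]; norm_num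

lemma taylor_deriv (δ' : Derivation K (PolyUV3 K) (PolyUV3 K))
    (hu1 : δ' (uP K 0) = 0) (hu2 : δ' (uP K 1) = uP K 0) (hu3 : δ' (uP K 2) = uP K 1)
    (hv1 : δ' (vP K 0) = 0) (hv2 : δ' (vP K 1) = vP K 0) (hv3 : δ' (vP K 2) = vP K 1)
    (p : PolyUV3 K) : Polynomial.derivative (taylorF K p) = taylorF K (δ' p) := by
  have hh : Polynomial.C (C (1/2) : PolyUV3 K) * 2 = 1 := by
    have := congrArg Polynomial.C (half_two (K := K))
    rw [Polynomial.C_mul, Polynomial.C_1] at this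
    rw [← this]; rfl
  have T1 : taylorF K (uP K 0) = Polynomial.C (uP K 0) := by simp [taylorF, uP]
  have T2 : taylorF K (uP K 1) =
    Polynomial.C (uP K 1) + Polynomial.C (uP K 0) * Polynomial.X := by simp [taylorF, uP]
  have T3 : taylorF K (uP K 2) = Polynomial.C (uP K 2) + Polynomial.C (uP K 1) * Polynomial.X
        + Polynomial.C (C (1/2)) * Polynomial.C (uP K 0) * Polynomial.X ^ 2 := by
    simp [taylorF, uP]
  have S1 : taylorF K (vP K 0) = Polynomial.C (vP K 0) := by simp [taylorF, vP]
  have S2 : taylorF K (vP K 1) =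
    Polynomial.C (vP K 1) + Polynomial.C (vP K 0) * Polynomial.X := by simp [taylorF, vP]
  have S3 : taylorF K (vP K 2) = Polynomial.C (vP K 2) + Polynomial.C (vP K 1) * Polynomial.X
        + Polynomial.C (C (1/2)) * Polynomial.C (vP K 0) * Polynomial.X ^ 2 := by
    simp [taylorF, vP]
  have gen : ∀ i, Polynomial.derivative (taylorF K (X i)) = taylorF K (δ' (X i)) := by
    rintro (i | i)
    · change Polynomial.derivative (taylorF K (uP K i)) = taylorF K (δ' (uP K i))
      fin_cases i
      · simp [hu1, T1]
      · simp [hu2, T1, T2]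
      · simp only [Fin.reduceFinMk, hu3, T2, T3, Polynomial.derivative_add,
          Polynomial.derivative_mul, Polynomial.derivative_C, Polynomial.derivative_X,
          Polynomial.derivative_X_sq]
        simp only [map_ofNat]
        linear_combination (Polynomial.C (uP K 0) * Polynomial.X) * hh
    · change Polynomial.derivative (taylorF K (vP K i)) = taylorF K (δ' (vP K i))
      fin_cases i
      · simp [hv1, S1]
      · simp [hv2, S1, S2]
      · simp only [Fin.reduceFinMk, hv3, S2, S3, Polynomial.derivative_add,
          Polynomial.derivative_mul, Polynomial.derivative_C, Polynomial.derivative_X,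
          Polynomial.derivative_X_sq]
        simp only [map_ofNat]
        linear_combination (Polynomial.C (vP K 0) * Polynomial.X) * hh
  induction p using MvPolynomial.induction_on with
  | C x =>
    have : (C x : PolyUV3 K) = algebraMap K _ x := rfl
    rw [this, Derivation.map_algebraMap, AlgHom.commutes, map_zero]
    exact Polynomial.derivative_C
  | add p q hp hq => simp only [map_add, hp, hq]
  | mul_X p i hp =>
    rw [map_mul, Polynomial.derivative_mul, hp, gen, Derivation.leibniz, map_add, smul_eq_mul,
      smul_eq_mul, map_mul, map_mul]
    ring

lemma taylor_const (p : PolyUV3 K)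
    (h : Polynomial.derivative (taylorF K p) = 0) : taylorF K p = Polynomial.C p := by
  have h1 := Polynomial.derivative_eq_zero.mp h
  rw [Polynomial.eq_C_of_natDegree_eq_zero h1]
  congr 1
  rw [Polynomial.coeff_zero_eq_aeval_zero]
  have : ((Polynomial.aeval (0 : PolyUV3 K)).restrictScalars K).comp (taylorF K)
      = AlgHom.id K _ := by
    apply MvPolynomial.algHom_ext
    rintro (i | i) <;> fin_cases i <;> simp [taylorF, uP, vP]
  exact DFunLike.congr_fun this p

lemma exists_pow_aux (L : Type*) [Field L] [Algebra (PolyUV3 K) L] [Algebra K L]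
    [IsScalarTower K (PolyUV3 K) L] [IsFractionRing (PolyUV3 K) L]
    (p : PolyUV3 K) (h : taylorF K p = Polynomial.C p) :
    ∃ n : ℕ, f1 K ^ n * p ∈ (evF K).range := by
  let j : PolyUV3 K →ₐ[K] L := IsScalarTower.toAlgHom K _ L
  have jinj : Function.Injective j := IsFractionRing.injective (PolyUV3 K) L
  have hne : j (uP K 0) ≠ 0 := by
    rw [← map_zero j]
    exact fun h => (X_ne_zero (R := K) (Sum.inl (0 : Fin 3))) (jinj h)
  let G : PolyUV3 K →ₐ[K] L :=
    ((Polynomial.aeval (R := PolyUV3 K) (- j (uP K 1) / j (uP K 0))).restrictScalars K).comp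
      (taylorF K)
  have hG : G p = j p := by
    simp only [G, AlgHom.comp_apply, h]
    exact Polynomial.aeval_C _ _
  have hh : j (C (1/2) : PolyUV3 K) * 2 = 1 := by
    have := congrArg j (half_two (K := K))
    simpa only [map_mul, map_one, map_ofNat] using this
  have am : ∀ x : PolyUV3 K, algebraMap (PolyUV3 K) L x = j x := fun _ => rfl
  have all : ∀ p, ∃ n : ℕ, ∃ c ∈ (evF K).range, j (f1 K) ^ n * G p = j c := by
    have F := mem_range_f (K := K)
    have F1 : f1 K ∈ (evF K).range := F 0
    have F2 : f2 K ∈ (evF K).range := F 1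
    have F3 : f3 K ∈ (evF K).range := F 2
    have F4 : f4 K ∈ (evF K).range := F 3
    have F5 : f5 K ∈ (evF K).range := F 4
    have F6 : f6 K ∈ (evF K).range := F 5
    have Fh : (C (1/2) : PolyUV3 K) ∈ (evF K).range := (evF K).range.algebraMap_mem (1/2)
    have gen : ∀ i, ∃ n : ℕ, ∃ c ∈ (evF K).range, j (f1 K) ^ n * G (X i) = j c := by
      rintro (i | i)
      · fin_cases i
        · refine ⟨0, f1 K, F1, ?_⟩
          simp [G, taylorF, am, f1]
        · refine ⟨0, 0, zero_mem _, ?_⟩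
          simp [G, taylorF, am]
          field_simp
          ring
        · refine ⟨1, - C (1/2) * f3 K, mul_mem (neg_mem Fh) F3, ?_⟩
          simp only [G, taylorF, AlgHom.comp_apply, aeval_X, Fin.reduceFinMk, Sum.elim_inl,
            AlgHom.restrictScalars_apply, Matrix.cons_val, map_add, map_mul, map_neg, map_pow,
            Polynomial.aeval_C, Polynomial.aeval_X, am, f1, f3, map_sub, map_ofNat]
          field_simp
          linear_combination (j (uP K 1) ^ 2 - j (uP K 0) * j (uP K 2)) * hh
      · fin_cases i
        · refine ⟨0, f2 K, F2, ?_⟩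
          simp [G, taylorF, am, f2]
        · refine ⟨1, f6 K, F6, ?_⟩
          simp [G, taylorF, am, f1, f6]
          field_simp
          ring
        · refine ⟨2, f1 K * f5 K + C (1/2) * (f2 K * f3 K),
            add_mem (mul_mem F1 F5) (mul_mem Fh (mul_mem F2 F3)), ?_⟩
          simp only [G, taylorF, AlgHom.comp_apply, aeval_X, Fin.reduceFinMk, Sum.elim_inr,
            AlgHom.restrictScalars_apply, Matrix.cons_val, map_add, map_mul, map_neg, map_pow,
            Polynomial.aeval_C, Polynomial.aeval_X, am, f1, f2, f5, f3, map_sub, map_ofNat]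
          field_simp
          linear_combination (j (uP K 0) * j (uP K 2) * j (vP K 0)) * hh
    intro p
    induction p using MvPolynomial.induction_on with
    | C x =>
      refine ⟨0, algebraMap K _ x, (evF K).range.algebraMap_mem x, ?_⟩
      have : (C x : PolyUV3 K) = algebraMap K _ x := rfl
      rw [this, AlgHom.commutes, AlgHom.commutes]; simp
    | add p q hp hq =>
      obtain ⟨n, c, hc, e⟩ := hp
      obtain ⟨m, d, hd, e'⟩ := hq
      refine ⟨n + m, f1 K ^ m * c + f1 K ^ n * d,
        add_mem (mul_mem (pow_mem F1 _) hc) (mul_mem (pow_mem F1 _) hd), ?_⟩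
      simp only [map_add, map_mul, map_pow, ← e, ← e']
      ring
    | mul_X p i hp =>
      obtain ⟨n, c, hc, e⟩ := hp
      obtain ⟨m, d, hd, e'⟩ := gen i
      refine ⟨n + m, c * d, mul_mem hc hd, ?_⟩
      simp only [map_mul, ← e, ← e']
      ring
  obtain ⟨n, c, hc, e⟩ := all p
  refine ⟨n, ?_⟩
  rw [hG, ← map_pow, ← map_mul] at e
  rwa [jinj e]

lemma exists_pow (p : PolyUV3 K) (h : taylorF K p = Polynomial.C p) :
    ∃ n : ℕ, f1 K ^ n * p ∈ (evF K).range :=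
  exists_pow_aux (FractionRing (PolyUV3 K)) p h

lemma adjoin_eq : Algebra.adjoin K {f1 K, f2 K, f3 K, f4 K, f5 K} = (phiF K).range := by
  rw [phiF, ← Algebra.adjoin_range_eq_range_aeval]
  congr 1
  ext x
  simp
  tauto

end helpers

/-- For the derivation `δ` of `K[U₃,V₃]` with `δ(u₁)=0, δ(u₂)=u₁,
δ(u₃)=u₂` and likewise for the `v`'s: (1) `f₁,…,f₆` are constants of `δ`;
(2) `f₆² = f₁²f₄ + f₂²f₃ + 2f₁f₂f₅`; (3) `f₁,…,f₅` are algebraically independent;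
(4) `K[U₃,V₃]^δ` is a free `K[f₁,…,f₅]`-module with basis `{1, f₆}`; in particular
`K[U₃,V₃]^δ` is generated by `f₁,…,f₆` with the single defining relation
`f₆² = f₁²f₄ + f₂²f₃ + 2f₁f₂f₅`. -/
theorem constants_of_K_U3_V3
    (K : Type*) [Field K] [CharZero K]
    (δ' : Derivation K (PolyUV3 K) (PolyUV3 K))
    (hu1 : δ' (uP K 0) = 0) (hu2 : δ' (uP K 1) = uP K 0) (hu3 : δ' (uP K 2) = uP K 1)
    (hv1 : δ' (vP K 0) = 0) (hv2 : δ' (vP K 1) = vP K 0) (hv3 : δ' (vP K 2) = vP K 1) :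
    (δ' (f1 K) = 0 ∧ δ' (f2 K) = 0 ∧ δ' (f3 K) = 0 ∧ δ' (f4 K) = 0 ∧
      δ' (f5 K) = 0 ∧ δ' (f6 K) = 0) ∧
    (f6 K ^ 2 = f1 K ^ 2 * f4 K + f2 K ^ 2 * f3 K + 2 * f1 K * f2 K * f5 K) ∧
    (AlgebraicIndependent K ![f1 K, f2 K, f3 K, f4 K, f5 K]) ∧
    (∀ p : PolyUV3 K, δ' p = 0 →
      ∃! q : PolyUV3 K × PolyUV3 K,
        q.1 ∈ Algebra.adjoin K {f1 K, f2 K, f3 K, f4 K, f5 K} ∧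
        q.2 ∈ Algebra.adjoin K {f1 K, f2 K, f3 K, f4 K, f5 K} ∧
        p = q.1 + q.2 * f6 K) ∧
    (∀ p : PolyUV3 K, δ' p = 0 ↔ p ∈ Set.range (evF K)) ∧
    (RingHom.ker (evF K).toRingHom
      = Ideal.span {(MvPolynomial.X 5 : MvPolynomial (Fin 6) K) ^ 2
          - (MvPolynomial.X 0 ^ 2 * MvPolynomial.X 3
              + MvPolynomial.X 1 ^ 2 * MvPolynomial.X 2
              + 2 * MvPolynomial.X 0 * MvPolynomial.X 1 * MvPolynomial.X 4)}) := by
  have c1 : δ' (f1 K) = 0 := hu1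
  have c2 : δ' (f2 K) = 0 := hv1
  have two : δ' (2 : PolyUV3 K) = 0 := by
    have : (2 : PolyUV3 K) = algebraMap K _ 2 := (map_ofNat (algebraMap K (PolyUV3 K)) 2).symm
    rw [this, Derivation.map_algebraMap]
  have c3 : δ' (f3 K) = 0 := by
    simp only [f3, pow_two, map_sub, Derivation.leibniz, smul_eq_mul, hu1, hu2, hu3, two]; ring
  have c4 : δ' (f4 K) = 0 := by
    simp only [f4, pow_two, map_sub, Derivation.leibniz, smul_eq_mul, hv1, hv2, hv3, two]; ring
  have c5 : δ' (f5 K) = 0 := by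
    simp only [f5, map_sub, map_add, Derivation.leibniz, smul_eq_mul, hu1, hu2, hu3,
      hv1, hv2, hv3]; ring
  have c6 : δ' (f6 K) = 0 := by
    simp only [f6, map_sub, Derivation.leibniz, smul_eq_mul, hu1, hu2, hv1, hv2]; ring
  have hker : ∀ p : PolyUV3 K, δ' p = 0 → p ∈ (evF K).range := by
    intro p hp
    have h1 := taylor_deriv δ' hu1 hu2 hu3 hv1 hv2 hv3 p
    rw [hp, map_zero] at h1
    obtain ⟨n, hn⟩ := exists_pow p (taylor_const p h1)
    exact range_of_pow_mul n p hn
  refine ⟨⟨c1, c2, c3, c4, c5, c6⟩, f6_sq_aux K, ?_, ?_, ?_, ?_⟩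
  · change Function.Injective (phiF K)
    rw [injective_iff_map_eq_zero]
    intro a ha
    exact (indep a 0 (by rw [ha]; simp)).1
  · intro p hp
    obtain ⟨g, rfl⟩ := hker p hp
    obtain ⟨a, b, hab⟩ := range_form g
    simp only [adjoin_eq]
    refine ⟨(phiF K a, phiF K b), ⟨⟨a, rfl⟩, ⟨b, rfl⟩, hab⟩, ?_⟩
    rintro ⟨q1, q2⟩ ⟨⟨a', ha⟩, ⟨b', hb⟩, h⟩
    change phiF K a' = q1 at ha
    change phiF K b' = q2 at hb
    change evF K g = q1 + q2 * f6 K at h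
    subst ha hb
    have := indep (a' - a) (b' - b) (by
      rw [map_sub, map_sub]; linear_combination hab - h)
    rw [sub_eq_zero.mp this.1, sub_eq_zero.mp this.2]
  · intro p
    refine ⟨fun h => hker p h, ?_⟩
    rintro ⟨g, rfl⟩
    induction g using MvPolynomial.induction_on with
    | C x =>
      have : (MvPolynomial.C x : MvPolynomial (Fin 6) K) = algebraMap K _ x := rfl
      rw [this, AlgHom.commutes, Derivation.map_algebraMap]
    | add p q hp hq => rw [map_add, map_add, hp, hq, add_zero]
    | mul_X p i hp =>
      rw [map_mul, Derivation.leibniz, hp]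
      have : δ' (evF K (MvPolynomial.X i)) = 0 := by
        fin_cases i <;> simp [evF, c1, c2, c3, c4, c5, c6]
      rw [this]; simp
  · change _ = Ideal.span {relF K}
    ext g
    rw [Ideal.mem_span_singleton, RingHom.mem_ker]
    change evF K g = 0 ↔ _
    constructor
    · intro h
      obtain ⟨a, b, c, rfl⟩ := normal_form g
      rw [map_add, map_add, map_mul, map_mul, ev_rel, ev_iota, ev_iota, ev_X5, mul_zero,
        add_zero] at h
      obtain ⟨rfl, rfl⟩ := indep a b h
      simp
    · rintro ⟨c, rfl⟩
      rw [map_mul, ev_rel, zero_mul]
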